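/- Key limit of Section 5: let a, b, d, e ∈ ℂ with Re(d+e−a−b−1) > 0 and Re(a−e+1) > 0, and assume none of d, e, a, b, d−a, b−e+1 is a nonpositive integer. Then lim_{n→∞} [(b)_n (d−a)_n / ((d)_n (b−e+1)_n)] · ∑_{k=0}^∞ (a)_k (b+n)_k (1)_k / ((d+n)_k (e)_k · k!) = Γ(d) Γ(e) Γ(a−e+1) Γ(b−e+1) Γ(d+e−a−b−1) / (Γ(a) Γ(b) Γ(d−a) Γ(d−b)). -/

import Mathlib

open Complex Filter

/-- Pochhammer symbol `(a)_k = a (a+1) ⋯ (a+k-1)`. -/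
noncomputable def poch (a : ℂ) (k : ℕ) : ℂ := ∏ i ∈ Finset.range k, (a + i)

open scoped Topology

section Pochhammer

lemma poch_zero (a : ℂ) : poch a 0 = 1 := by simp [poch]

lemma poch_succ (a : ℂ) (k : ℕ) : poch a (k + 1) = poch a k * (a + k) := by
  simp [poch, Finset.prod_range_succ]

lemma poch_ne_zero {a : ℂ} (ha : ∀ m : ℕ, a ≠ -(m : ℂ)) (k : ℕ) : poch a k ≠ 0 :=
  Finset.prod_ne_zero_iff.mpr fun i _ h => ha i (eq_neg_of_add_eq_zero_left h)

lemma poch_one (k : ℕ) : poch 1 k = (k.factorial : ℂ) := by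
  induction k with
  | zero => simp [poch_zero]
  | succ k ih => rw [poch_succ, ih, Nat.factorial_succ]; push_cast; ring

lemma poch_add (a : ℂ) (m k : ℕ) : poch a (m + k) = poch a m * poch (a + m) k := by
  simp [poch, Finset.prod_range_add, add_assoc]

lemma Gamma_add_natCast {a : ℂ} (ha : ∀ m : ℕ, a ≠ -(m : ℂ)) (k : ℕ) :
    Gamma (a + k) = poch a k * Gamma a := by
  induction k with
  | zero => simp [poch_zero]
  | succ k ih =>
    have hk : a + k ≠ 0 := fun h => ha k (eq_neg_of_add_eq_zero_left h)
    rw [Nat.cast_succ, ← add_assoc, Gamma_add_one _ hk, ih, poch_succ]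
    ring

lemma ne_neg_natCast_of_re_pos {a : ℂ} (ha : 0 < a.re) (m : ℕ) : a ≠ -(m : ℂ) := by
  rintro rfl
  simp only [neg_re, natCast_re, Left.neg_pos_iff] at ha
  exact absurd ha (not_lt.mpr m.cast_nonneg)

lemma add_natCast_ne_neg_natCast {a : ℂ} (ha : ∀ m : ℕ, a ≠ -(m : ℂ)) (k m : ℕ) :
    a + k ≠ -(m : ℂ) := fun h => ha (m + k) (by push_cast; linear_combination h)

lemma poch_ofReal (x : ℝ) (k : ℕ) :
    poch x k = ((∏ i ∈ Finset.range k, (x + i) : ℝ) : ℂ) := by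
  simp [poch]

lemma tendsto_add_natCast_div (x z : ℂ) :
    Tendsto (fun n : ℕ => (z + n) / (x + n)) atTop (𝓝 1) := by
  have key (w : ℂ) : Tendsto (fun n : ℕ => w / (n : ℂ) + 1) atTop (𝓝 1) := by
    simpa using (tendsto_const_div_atTop_nhds_zero_nat w).add_const 1
  have := (key z).div (key x) one_ne_zero
  rw [div_one] at this
  refine this.congr' ?_
  filter_upwards [eventually_ne_atTop 0] with n hn
  have hn' : (n : ℂ) ≠ 0 := Nat.cast_ne_zero.mpr hn
  simp only [Pi.div_apply]
  rw [div_add_one hn', div_add_one hn', div_div_div_cancel_right₀ hn']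

/-- Growth of a quotient of Pochhammer symbols. -/
lemma tendsto_cpow_mul_poch_div_poch {x : ℂ} (hx : ∀ m : ℕ, x ≠ -(m : ℂ)) (z : ℂ) :
    Tendsto (fun n : ℕ => (n : ℂ) ^ (z - x) * (poch x n / poch z n)) atTop
      (𝓝 (Gamma z / Gamma x)) := by
  have h := ((GammaSeq_tendsto_Gamma z).div (GammaSeq_tendsto_Gamma x) (Gamma_ne_zero hx)).mul
    (tendsto_add_natCast_div x z)
  rw [mul_one] at h
  refine h.congr' ?_
  obtain ⟨N, hN⟩ := exists_nat_gt (-z.re)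
  filter_upwards [eventually_ne_atTop 0, eventually_ge_atTop N] with n hn hNn
  have hn' : (n : ℂ) ≠ 0 := Nat.cast_ne_zero.mpr hn
  have hxn : x + n ≠ 0 := fun h => hx n (eq_neg_of_add_eq_zero_left h)
  have hzn : z + n ≠ 0 := by
    intro h
    have h2 := congrArg re h
    rw [add_re, natCast_re, zero_re] at h2
    have : (N : ℝ) ≤ n := Nat.cast_le.mpr hNn
    linarith
  have hf : (n.factorial : ℂ) ≠ 0 := Nat.cast_ne_zero.mpr n.factorial_ne_zero
  have hxz := poch_ne_zero hx n
  have e1 (w : ℂ) : GammaSeq w n = (n : ℂ) ^ w * n.factorial / (poch w n * (w + n)) := by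
    rw [← poch_succ]; rfl
  have hnx : (n : ℂ) ^ x ≠ 0 := by simp [cpow_eq_zero_iff, hn']
  simp only [Pi.div_apply]
  rw [e1, e1, cpow_sub _ _ hn']
  field_simp

lemma tendsto_rpow_mul_norm_poch_div_poch {x : ℂ} (hx : ∀ m : ℕ, x ≠ -(m : ℂ)) (z : ℂ) :
    Tendsto (fun n : ℕ => (n : ℝ) ^ (z.re - x.re) * ‖poch x n / poch z n‖) atTop
      (𝓝 ‖Gamma z / Gamma x‖) := by
  refine (tendsto_cpow_mul_poch_div_poch hx z).norm.congr' ?_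
  filter_upwards [eventually_gt_atTop 0] with n hn
  rw [norm_mul, norm_natCast_cpow_of_pos hn, sub_re]

end Pochhammer

lemma hasSum_poch_div_factorial_mul_pow (α : ℂ) {t : ℂ} (ht : ‖t‖ < 1) :
    HasSum (fun k : ℕ => poch α k / k.factorial * t ^ k) ((1 - t) ^ (-α)) := by
  have h := (one_div_one_sub_cpow_hasFPowerSeriesOnBall_zero α).hasSum (y := t)
    (by rw [← ENNReal.ofReal_one, Metric.eball_ofReal]; simpa using ht)
  simp only [FormalMultilinearSeries.ofScalars_apply_eq, smul_eq_mul, zero_add, one_div,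
    ← cpow_neg] at h
  have key (k : ℕ) : Ring.choose (α + k - 1) k = poch α k / k.factorial := by
    rw [← Ring.multichoose_eq, eq_div_iff (Nat.cast_ne_zero.mpr k.factorial_ne_zero), mul_comm,
      ← nsmul_eq_mul, Ring.factorial_nsmul_multichoose_eq_ascPochhammer,
      Polynomial.ascPochhammer_smeval_eq_eval]
    induction k with
    | zero => simp [poch_zero]
    | succ k ih => rw [poch_succ, ← ih, ascPochhammer_succ_eval]
  simpa only [key] using h

/-- Toeplitz's theorem on regular summation methods. -/
lemma tendsto_tsum_mul_of_tendsto {w : ℕ → ℕ → ℂ} {r S : ℕ → ℂ} {L T : ℂ} {M : ℝ}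
    (hw : ∀ n, Summable fun k => ‖w n k‖) (hM : ∀ n, ∑' k, ‖w n k‖ ≤ M)
    (hS : ∀ n, HasSum (w n) (S n)) (hT : Tendsto S atTop (𝓝 T))
    (h0 : ∀ k, Tendsto (fun n => w n k) atTop (𝓝 0)) (hr : Tendsto r atTop (𝓝 L)) :
    Tendsto (fun n => ∑' k, w n k * r k) atTop (𝓝 (T * L)) := by
  have hε : Tendsto (fun k => ‖r k - L‖) atTop (𝓝 0) := tendsto_iff_norm_sub_tendsto_zero.mp hr
  obtain ⟨B, hB⟩ := hε.bddAbove_range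
  replace hB : ∀ k, ‖r k - L‖ ≤ B := fun k => hB ⟨k, rfl⟩
  have hsum (n : ℕ) : Summable fun k => ‖w n k * (r k - L)‖ := by
    refine .of_nonneg_of_le (fun _ => norm_nonneg _) (fun k => ?_) ((hw n).mul_right B)
    rw [norm_mul]
    exact mul_le_mul_of_nonneg_left (hB k) (norm_nonneg _)
  have hM0 : 0 ≤ M := (tsum_nonneg fun _ => norm_nonneg _).trans (hM 0)
  have key : Tendsto (fun n => ∑' k, w n k * (r k - L)) atTop (𝓝 0) := by
    rw [Metric.tendsto_nhds]
    intro δ hδ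
    obtain ⟨K, hK⟩ := eventually_atTop.mp
      (hε.eventually_le_const (show 0 < δ / (2 * (M + 1)) by positivity))
    have hfin : Tendsto (fun n => ∑ k ∈ Finset.range K, ‖w n k‖ * B) atTop (𝓝 0) := by
      have := tendsto_finsetSum (Finset.range K) fun k _ => ((h0 k).norm.mul_const B)
      simpa using this
    filter_upwards [hfin.eventually_lt_const (half_pos hδ)] with n hn
    rw [dist_zero_right]
    calc ‖∑' k, w n k * (r k - L)‖ ≤ ∑' k, ‖w n k * (r k - L)‖ := norm_tsum_le_tsum_norm (hsum n)
      _ = ∑ k ∈ Finset.range K, ‖w n k * (r k - L)‖ + ∑' k, ‖w n (k + K) * (r (k + K) - L)‖ :=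
        ((hsum n).sum_add_tsum_nat_add K).symm
      _ ≤ ∑ k ∈ Finset.range K, ‖w n k‖ * B + ∑' k, ‖w n (k + K)‖ * (δ / (2 * (M + 1))) := by
        gcongr with k hk k
        · rw [norm_mul]
          exact mul_le_mul_of_nonneg_left (hB k) (norm_nonneg _)
        · exact (summable_nat_add_iff K).mpr (hsum n)
        · exact ((summable_nat_add_iff K).mpr (hw n)).mul_right _
        · rw [norm_mul]
          exact mul_le_mul_of_nonneg_left (hK _ (Nat.le_add_left _ _)) (norm_nonneg _)
      _ ≤ ∑ k ∈ Finset.range K, ‖w n k‖ * B + M * (δ / (2 * (M + 1))) := by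
        rw [tsum_mul_right]
        gcongr
        refine le_trans ?_ (hM n)
        rw [← (hw n).sum_add_tsum_nat_add K]
        exact le_add_of_nonneg_left (Finset.sum_nonneg fun _ _ => norm_nonneg _)
      _ < δ / 2 + δ / 2 := by
        refine add_lt_add_of_lt_of_le hn ?_
        rw [← mul_div_assoc, div_le_div_iff₀ (by positivity) two_pos]
        nlinarith
      _ = δ := add_halves δ
  have := key.add (hT.mul_const L)
  rw [zero_add] at this
  refine this.congr fun n => ?_
  rw [← (hS n).tsum_eq, ← tsum_mul_right,
    ← (hsum n).of_norm.tsum_add ((hS n).summable.mul_right L)]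
  exact tsum_congr fun k => by ring

section Beta

open MeasureTheory Set

lemma betaIntegral_eq_setIntegral_Ioo (u v : ℂ) :
    betaIntegral u v = ∫ t in Ioo (0 : ℝ) 1, (t : ℂ) ^ (u - 1) * (1 - (t : ℂ)) ^ (v - 1) := by
  rw [betaIntegral, intervalIntegral.integral_of_le zero_le_one, integral_Ioc_eq_integral_Ioo]

lemma integrableOn_betaIntegral {u v : ℂ} (hu : 0 < u.re) (hv : 0 < v.re) :
    IntegrableOn (fun t : ℝ => (t : ℂ) ^ (u - 1) * (1 - (t : ℂ)) ^ (v - 1)) (Ioo 0 1) :=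
  ((intervalIntegrable_iff_integrableOn_Ioc_of_le zero_le_one).mp
    (betaIntegral_convergent hu hv)).mono_set Ioo_subset_Ioc_self

lemma betaIntegral_ofReal {x y : ℝ} (hx : 0 < x) (hy : 0 < y) :
    betaIntegral x y = (ProbabilityTheory.beta x y : ℂ) := by
  rw [betaIntegral_eq_Gamma_mul_div _ _ (by simpa) (by simpa), ← ofReal_add, Gamma_ofReal,
    Gamma_ofReal, Gamma_ofReal, ProbabilityTheory.beta]
  push_cast
  rfl

lemma setIntegral_norm_betaIntegral {u v : ℂ} (hu : 0 < u.re) (hv : 0 < v.re) :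
    ∫ t in Ioo (0 : ℝ) 1, ‖(t : ℂ) ^ (u - 1) * (1 - (t : ℂ)) ^ (v - 1)‖ =
      ProbabilityTheory.beta u.re v.re := by
  rw [← ofReal_inj, ← betaIntegral_ofReal hu hv, betaIntegral_eq_setIntegral_Ioo,
    ← integral_complex_ofReal]
  refine setIntegral_congr_fun measurableSet_Ioo fun t ht => ?_
  have ht1 : 0 < 1 - t := sub_pos.mpr ht.2
  have e1 : (1 - (t : ℂ)) = ((1 - t : ℝ) : ℂ) := by push_cast; rfl
  rw [norm_mul, e1, norm_cpow_eq_rpow_re_of_pos ht.1, norm_cpow_eq_rpow_re_of_pos ht1, ofReal_mul,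
    ofReal_cpow ht.1.le, ofReal_cpow ht1.le]
  simp

lemma norm_betaIntegral_le {u v : ℂ} (hu : 0 < u.re) (hv : 0 < v.re) :
    ‖betaIntegral u v‖ ≤ ProbabilityTheory.beta u.re v.re := by
  rw [betaIntegral_eq_setIntegral_Ioo, ← setIntegral_norm_betaIntegral hu hv]
  exact norm_integral_le_integral_norm _

lemma betaIntegral_add_natCast {u v : ℂ} (hu : 0 < u.re) (hv : 0 < v.re) (k : ℕ) :
    betaIntegral (u + k) v = betaIntegral u v * (poch u k / poch (u + v) k) := by
  have huv : 0 < (u + v).re := add_pos hu hv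
  have hk : 0 < (u + k).re := by
    rw [add_re, natCast_re]; positivity
  rw [betaIntegral_eq_Gamma_mul_div _ _ hu hv, betaIntegral_eq_Gamma_mul_div _ _ hk hv,
    add_right_comm, Gamma_add_natCast (ne_neg_natCast_of_re_pos hu),
    Gamma_add_natCast (ne_neg_natCast_of_re_pos huv)]
  have := Gamma_ne_zero_of_re_pos huv
  have := poch_ne_zero (ne_neg_natCast_of_re_pos huv) k
  field_simp

lemma summable_norm_poch_mul_beta {α : ℂ} {x y : ℝ} (hα : 0 < α.re) (hx : 0 < x)
    (hy : α.re < y) :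
    Summable fun k : ℕ => ‖poch α k / k.factorial‖ * ProbabilityTheory.beta (x + k) y := by
  have hy0 : 0 < y := hα.trans hy
  have hx' : 0 < (x : ℂ).re := by simpa
  have h1 := tendsto_rpow_mul_norm_poch_div_poch (ne_neg_natCast_of_re_pos hα) 1
  have h2 := tendsto_rpow_mul_norm_poch_div_poch (ne_neg_natCast_of_re_pos hx') (x + y)
  have h3 := ((h1.mul h2).mul_const ‖betaIntegral x y‖).isBigO_one ℝ
  have hs : Summable fun k : ℕ => ((k : ℝ) ^ (1 + (y - α.re)))⁻¹ :=
    Real.summable_nat_rpow_inv.mpr (by linarith)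
  refine summable_of_isBigO_nat hs ?_
  have h4 := h3.mul (Asymptotics.isBigO_refl (fun k : ℕ => ((k : ℝ) ^ (1 + (y - α.re)))⁻¹) atTop)
  simp only [one_mul] at h4
  refine h4.congr' ?_ .rfl
  filter_upwards [eventually_gt_atTop 0] with k hk
  have hk' : (0 : ℝ) < k := Nat.cast_pos.mpr hk
  have hxk : 0 < x + k := by positivity
  have e := betaIntegral_add_natCast (u := x) (v := y) hx' (by simpa) k
  rw [← ofReal_natCast, ← ofReal_add, betaIntegral_ofReal hxk hy0] at e
  have e' := congrArg norm e
  rw [norm_mul, norm_real, Real.norm_of_nonneg (ProbabilityTheory.beta_pos hxk hy0).le] at e'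
  rw [e', poch_one]
  have e5 : (k : ℝ) ^ (1 + (y - α.re)) =
      (k : ℝ) ^ ((1 : ℂ).re - α.re) * (k : ℝ) ^ ((x + y : ℂ).re - (x : ℂ).re) := by
    rw [← Real.rpow_add hk']
    congr 1
    simp
    ring
  rw [e5]
  have := (Real.rpow_pos_of_pos hk' ((1 : ℂ).re - α.re)).ne'
  have := (Real.rpow_pos_of_pos hk' ((x + y : ℂ).re - (x : ℂ).re)).ne'
  field_simp

/-- **Gauss's summation theorem**, in terms of the Beta integral. -/
lemma hasSum_poch_mul_betaIntegral {α u v : ℂ} (hα : 0 < α.re) (hu : 0 < u.re)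
    (hv : α.re < v.re) :
    HasSum (fun k : ℕ => poch α k / k.factorial * betaIntegral (u + k) v)
      (betaIntegral u (v - α)) := by
  have hv0 : 0 < v.re := hα.trans hv
  have huk (k : ℕ) : 0 < (u + k).re := by rw [add_re, natCast_re]; positivity
  have h := hasSum_integral_of_summable_integral_norm (μ := volume.restrict (Ioo (0 : ℝ) 1))
    (F := fun (k : ℕ) (t : ℝ) => poch α k / k.factorial *
      ((t : ℂ) ^ (u + k - 1) * (1 - (t : ℂ)) ^ (v - 1)))
    (fun k => (integrableOn_betaIntegral (huk k) hv0).const_mul _) (by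
      refine (summable_norm_poch_mul_beta hα hu hv).congr fun k => ?_
      simp_rw [norm_mul (poch α k / k.factorial)]
      rw [integral_const_mul, setIntegral_norm_betaIntegral (huk k) hv0, add_re, natCast_re])
  simp_rw [integral_const_mul, ← betaIntegral_eq_setIntegral_Ioo] at h
  refine (?_ : betaIntegral u (v - α) = _) ▸ h
  rw [betaIntegral_eq_setIntegral_Ioo]
  refine setIntegral_congr_fun measurableSet_Ioo fun t ht => ?_
  have ht0 : (t : ℂ) ≠ 0 := ofReal_ne_zero.mpr ht.1.ne'
  have ht1 : 1 - (t : ℂ) ≠ 0 := by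
    rw [← ofReal_one, ← ofReal_sub]
    exact ofReal_ne_zero.mpr (sub_pos.mpr ht.2).ne'
  have hb := (hasSum_poch_div_factorial_mul_pow α (t := t) (by
    rw [norm_real, Real.norm_of_nonneg ht.1.le]; exact ht.2)).mul_right
    ((t : ℂ) ^ (u - 1) * (1 - (t : ℂ)) ^ (v - 1))
  rw [show v - α - 1 = -α + (v - 1) by ring, cpow_add _ _ ht1, mul_left_comm, ← hb.tsum_eq]
  refine tsum_congr fun k => ?_
  rw [add_sub_right_comm, cpow_add _ _ ht0, cpow_natCast]
  ring

end Beta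

lemma tendsto_poch_div_poch_mul {x y z w : ℂ} (hx : ∀ m : ℕ, x ≠ -(m : ℂ))
    (hy : ∀ m : ℕ, y ≠ -(m : ℂ)) (h : x + y = z + w) :
    Tendsto (fun n : ℕ => poch x n / poch z n * (poch y n / poch w n)) atTop
      (𝓝 (Gamma z / Gamma x * (Gamma w / Gamma y))) := by
  refine ((tendsto_cpow_mul_poch_div_poch hx z).mul
    (tendsto_cpow_mul_poch_div_poch hy w)).congr' ?_
  filter_upwards [eventually_ne_atTop 0] with n hn
  have hn' : (n : ℂ) ≠ 0 := Nat.cast_ne_zero.mpr hn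
  rw [mul_mul_mul_comm, ← cpow_add _ _ hn',
    show z - x + (w - y) = 0 by linear_combination -h, cpow_zero, one_mul]

lemma tendsto_norm_poch_div_poch_mul {x y z w : ℂ} (hx : ∀ m : ℕ, x ≠ -(m : ℂ))
    (hy : ∀ m : ℕ, y ≠ -(m : ℂ)) (h : x.re + y.re = z.re + w.re) :
    Tendsto (fun n : ℕ => ‖poch x n / poch z n‖ * ‖poch y n / poch w n‖) atTop
      (𝓝 (‖Gamma z / Gamma x‖ * ‖Gamma w / Gamma y‖)) := by
  refine ((tendsto_rpow_mul_norm_poch_div_poch hx z).mul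
    (tendsto_rpow_mul_norm_poch_div_poch hy w)).congr' ?_
  filter_upwards [eventually_gt_atTop 0] with n hn
  rw [mul_mul_mul_comm, ← Real.rpow_add (Nat.cast_pos.mpr hn),
    show z.re - x.re + (w.re - y.re) = 0 by linarith, Real.rpow_zero, one_mul]

lemma tendsto_poch_div_poch_mul_zero {x y z w : ℂ} (hx : ∀ m : ℕ, x ≠ -(m : ℂ))
    (hy : ∀ m : ℕ, y ≠ -(m : ℂ)) (h : (x + y).re < (z + w).re) :
    Tendsto (fun n : ℕ => poch x n / poch z n * (poch y n / poch w n)) atTop (𝓝 0) := by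
  have h0 : Tendsto (fun n : ℕ => (n : ℝ) ^ (-((z + w).re - (x + y).re))) atTop (𝓝 0) :=
    (tendsto_rpow_neg_atTop (sub_pos.mpr h)).comp tendsto_natCast_atTop_atTop
  rw [tendsto_zero_iff_norm_tendsto_zero]
  have h1 := h0.mul ((tendsto_rpow_mul_norm_poch_div_poch hx z).mul
    (tendsto_rpow_mul_norm_poch_div_poch hy w))
  rw [zero_mul] at h1
  refine h1.congr' ?_
  filter_upwards [eventually_gt_atTop 0] with n hn
  have hn' : (0 : ℝ) < n := Nat.cast_pos.mpr hn
  rw [mul_mul_mul_comm, ← Real.rpow_add hn', ← mul_assoc, ← Real.rpow_add hn', norm_mul, add_re,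
    add_re, show -(z.re + w.re - (x.re + y.re)) + (z.re - x.re + (w.re - y.re)) = 0 by ring,
    Real.rpow_zero, one_mul]

/-- Gauss's summation theorem with real parameters. -/
lemma hasSum_norm_poch_mul_beta {α x y : ℝ} (hα : 0 < α) (hx : 0 < x) (hy : α < y) :
    HasSum (fun k : ℕ => ‖poch α k / k.factorial‖ * ProbabilityTheory.beta (x + k) y)
      (ProbabilityTheory.beta x (y - α)) := by
  have h := hasSum_poch_mul_betaIntegral (α := α) (u := x) (v := y) (by simpa) (by simpa)
    (by simpa)
  rw [← ofReal_sub, betaIntegral_ofReal hx (sub_pos.mpr hy)] at h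
  refine hasSum_ofReal.mp (h.congr_fun fun k => ?_)
  have hk : 0 < x + k := by positivity
  have hp : 0 ≤ ∏ i ∈ Finset.range k, (α + i) := Finset.prod_nonneg fun _ _ => by positivity
  rw [poch_ofReal, ← ofReal_natCast k.factorial, ← ofReal_div, norm_real,
    Real.norm_of_nonneg (by positivity), ← ofReal_natCast k, ← ofReal_add,
    betaIntegral_ofReal hk (hα.trans hy), ofReal_mul]

lemma exists_forall_tsum_norm_poch_mul_betaIntegral_le {α u v : ℂ} (hα : 0 < α.re)
    (hv : α.re < v.re) (hu : 0 < u.re) :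
    ∃ C : ℝ, 0 ≤ C ∧ ∀ n : ℕ,
      (Summable fun k : ℕ => ‖poch α k / k.factorial * betaIntegral (u + n + k) v‖) ∧
      ∑' k : ℕ, ‖poch α k / k.factorial * betaIntegral (u + n + k) v‖ ≤
        C * ProbabilityTheory.beta (u.re + n) (v.re - α.re) := by
  have hv0 : 0 < v.re := hα.trans hv
  have hr : ∀ m : ℕ, (α.re : ℂ) ≠ -(m : ℂ) := ne_neg_natCast_of_re_pos (by simpa)
  obtain ⟨C, hC⟩ := (tendsto_norm_poch_div_poch_mul (ne_neg_natCast_of_re_pos hα)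
    (y := 1) (z := α.re) (w := 1) (ne_neg_natCast_of_re_pos (by simp)) (by simp)).bddAbove_range
  have hC' (k : ℕ) : ‖poch α k‖ ≤ C * ‖poch α.re k‖ := by
    have h1 : poch 1 k ≠ 0 := poch_ne_zero (ne_neg_natCast_of_re_pos (by simp)) k
    have := hC ⟨k, rfl⟩
    simp only [div_self h1, norm_one, mul_one] at this
    rwa [norm_div, div_le_iff₀ (norm_pos_iff.mpr (poch_ne_zero hr k))] at this
  refine ⟨C, (by positivity : (0 : ℝ) ≤ _).trans (hC ⟨0, rfl⟩), fun n => ?_⟩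
  have hun : 0 < u.re + n := by positivity
  have hs := (hasSum_norm_poch_mul_beta hα hun hv).mul_left C
  have hle (k : ℕ) : ‖poch α k / k.factorial * betaIntegral (u + n + k) v‖ ≤
      C * (‖poch α.re k / k.factorial‖ * ProbabilityTheory.beta (u.re + n + k) v.re) := by
    have hk : (u + n + k).re = u.re + n + k := by simp
    rw [norm_mul, norm_div, norm_div, ← mul_assoc, ← mul_div_assoc]
    have := norm_betaIntegral_le (u := u + n + k) (by rw [hk]; positivity) hv0
    rw [hk] at this
    gcongr
    · have := (norm_nonneg _).trans (hC' k)
      positivity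
    · exact hC' k
  have hsum := Summable.of_nonneg_of_le (fun _ => norm_nonneg _) hle hs.summable
  exact ⟨hsum, (hsum.tsum_le_tsum hle hs.summable).trans_eq hs.tsum_eq⟩

lemma tendsto_poch_mul_tsum_of_re_pos {a b d e : ℂ} (hb : 0 < b.re)
    (hs : 0 < (d + e - a - b - 1).re) (hα : 0 < (a - e + 1).re)
    (ha : ∀ m : ℕ, a ≠ -(m : ℂ)) (hda : ∀ m : ℕ, d - a ≠ -(m : ℂ)) :
    Tendsto (fun n : ℕ =>
        poch b n * poch (d - a) n / (poch d n * poch (b - e + 1) n) *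
          ∑' k : ℕ, poch a k * poch (b + n) k * poch 1 k /
            (poch (d + n) k * poch e k * (Nat.factorial k : ℂ)))
      atTop
      (𝓝 (Gamma d * Gamma e * Gamma (a - e + 1) * Gamma (b - e + 1) *
          Gamma (d + e - a - b - 1) /
        (Gamma a * Gamma b * Gamma (d - a) * Gamma (d - b)))) := by
  obtain ⟨α, hαe⟩ : ∃ α, α = a - e + 1 := ⟨_, rfl⟩
  obtain ⟨v, hve⟩ : ∃ v, v = d - b := ⟨_, rfl⟩
  have hse : d + e - a - b - 1 = v - α := by rw [hve, hαe]; ring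
  rw [hse, ← hαe, ← hve]
  rw [hse] at hs
  rw [← hαe] at hα
  have hv : α.re < v.re := by simpa using hs
  have hv0 : 0 < v.re := hα.trans hv
  have hd : d = b + v := by rw [hve]; ring
  have hd0 : 0 < d.re := by rw [hd]; exact add_pos hb hv0
  have hbs : 0 < (b + (v - α)).re := add_pos hb hs
  have hb' := ne_neg_natCast_of_re_pos hb
  have hα' := ne_neg_natCast_of_re_pos hα
  have hbn (n : ℕ) : 0 < (b + n).re := by rw [add_re, natCast_re]; positivity
  set R : ℕ → ℂ := fun n => poch (d - a) n / poch (b - e + 1) n with hR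
  obtain ⟨C, hC0, hC⟩ := exists_forall_tsum_norm_poch_mul_betaIntegral_le hα hv hb
  have hr : Tendsto (fun k => poch a k / poch e k * (poch 1 k / poch α k)) atTop
      (𝓝 (Gamma e / Gamma a * (Gamma α / Gamma 1))) :=
    tendsto_poch_div_poch_mul ha (ne_neg_natCast_of_re_pos (by simp)) (by rw [hαe]; ring)
  have hS : Tendsto (fun n : ℕ => R n * betaIntegral (b + n) (v - α)) atTop
      (𝓝 (Gamma (v - α) * Gamma (b - e + 1) / Gamma (d - a))) := by
    have h1 := (tendsto_poch_div_poch_mul hda hb' (z := b - e + 1) (w := b + (v - α))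
      (by rw [hαe, hd]; ring)).mul_const (betaIntegral b (v - α))
    have h2 := Gamma_ne_zero_of_re_pos hbs
    have h3 := Gamma_ne_zero hb'
    have h4 := Gamma_ne_zero hda
    convert h1 using 2 with n
    · rw [betaIntegral_add_natCast hb hs]
      ring
    · rw [betaIntegral_eq_Gamma_mul_div _ _ hb hs]
      field_simp
  obtain ⟨M, hM⟩ := (tendsto_norm_poch_div_poch_mul hda (z := b - e + 1) (y := b.re)
    (w := b.re + (v.re - α.re)) (ne_neg_natCast_of_re_pos (by simpa))
    (by rw [hαe, hd]; simp; ring)).bddAbove_range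
  have hbound (n : ℕ) : ‖R n‖ * ProbabilityTheory.beta (b.re + n) (v.re - α.re) ≤
      M * ProbabilityTheory.beta b.re (v.re - α.re) := by
    have hs' : 0 < v.re - α.re := sub_pos.mpr hv
    have hn : 0 < b.re + n := by positivity
    have e1 := betaIntegral_add_natCast (u := b.re) (v := (v.re - α.re : ℝ)) (by simpa)
      (by simpa) n
    rw [← ofReal_natCast, ← ofReal_add, betaIntegral_ofReal hn hs', betaIntegral_ofReal hb hs'] at e1
    have e2 := congrArg norm e1
    rw [norm_mul, norm_real, norm_real,
      Real.norm_of_nonneg (ProbabilityTheory.beta_pos hn hs').le,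
      Real.norm_of_nonneg (ProbabilityTheory.beta_pos hb hs').le] at e2
    have e3 := hM ⟨n, rfl⟩
    have e4 := mul_le_mul_of_nonneg_right e3 (ProbabilityTheory.beta_pos hb hs').le
    rw [e2]
    refine le_trans (le_of_eq ?_) e4
    push_cast
    ring
  have key := tendsto_tsum_mul_of_tendsto
    (w := fun n k => R n * (poch α k / k.factorial * betaIntegral (b + n + k) v))
    (M := C * (M * ProbabilityTheory.beta b.re (v.re - α.re)))
    (fun n => by
      simp_rw [norm_mul (R n)]
      exact (hC n).1.mul_left _)
    (fun n => by
      simp_rw [norm_mul (R n)]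
      rw [tsum_mul_left]
      calc _ ≤ ‖R n‖ * (C * ProbabilityTheory.beta (b.re + n) (v.re - α.re)) :=
            mul_le_mul_of_nonneg_left (hC n).2 (norm_nonneg _)
        _ = C * (‖R n‖ * ProbabilityTheory.beta (b.re + n) (v.re - α.re)) := by ring
        _ ≤ _ := mul_le_mul_of_nonneg_left (hbound n) hC0)
    (fun n => (hasSum_poch_mul_betaIntegral hα (hbn n) hv).mul_left (R n)) hS
    (fun k => by
      have h1 := (tendsto_poch_div_poch_mul_zero hda (y := b + k) (z := b - e + 1)
        (w := b + k + v) (ne_neg_natCast_of_re_pos (hbn k)) (by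
          have : b - e + 1 + (b + k + v) = d - a + (b + k) + α := by rw [hαe, hd]; ring
          rw [this, add_re _ α]
          linarith)).mul_const (betaIntegral (b + k) v * (poch α k / k.factorial))
      rw [zero_mul] at h1
      refine h1.congr fun n => ?_
      rw [add_right_comm b (n : ℂ), betaIntegral_add_natCast (hbn k) hv0]
      ring) hr
  have hΓd := Gamma_ne_zero_of_re_pos hd0
  have hΓb := Gamma_ne_zero hb'
  have hΓv := Gamma_ne_zero_of_re_pos hv0
  convert key.const_mul (Gamma d / (Gamma b * Gamma v)) using 2 with n
  · rw [← tsum_mul_left, ← tsum_mul_left]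
    refine tsum_congr fun k => ?_
    have h1 := poch_ne_zero hα' k
    have h2 : (k.factorial : ℂ) ≠ 0 := Nat.cast_ne_zero.mpr k.factorial_ne_zero
    rw [betaIntegral_add_natCast (hbn n) hv0, betaIntegral_add_natCast hb hv0,
      betaIntegral_eq_Gamma_mul_div _ _ hb hv0, add_right_comm b, ← hd, poch_one, hR]
    field_simp
  · rw [Gamma_one, div_one]
    have := Gamma_ne_zero ha
    have := Gamma_ne_zero hda
    field_simp

/-- Key limit of Section 5. -/
theorem section5_key_limit (a b d e : ℂ)
    (hre1 : 0 < (d + e - a - b - 1).re) (hre2 : 0 < (a - e + 1).re)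
    (h : ∀ z ∈ [d, e, a, b, d - a, b - e + 1], ∀ m : ℕ, z ≠ -(m : ℂ)) :
    Tendsto (fun n : ℕ =>
        poch b n * poch (d - a) n / (poch d n * poch (b - e + 1) n) *
          ∑' k : ℕ, poch a k * poch (b + n) k * poch 1 k /
            (poch (d + n) k * poch e k * (Nat.factorial k : ℂ)))
      atTop
      (nhds (Complex.Gamma d * Complex.Gamma e * Complex.Gamma (a - e + 1) *
          Complex.Gamma (b - e + 1) * Complex.Gamma (d + e - a - b - 1) /
        (Complex.Gamma a * Complex.Gamma b * Complex.Gamma (d - a) *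
          Complex.Gamma (d - b)))) := by
  simp only [List.mem_cons, List.not_mem_nil, or_false, forall_eq_or_imp, forall_eq] at h
  obtain ⟨hd, -, ha, hb, hda, hbe⟩ := h
  obtain ⟨N, hN⟩ := exists_nat_gt (-b.re)
  have e1 : d + N + e - a - (b + N) - 1 = d + e - a - b - 1 := by ring
  have e2 : d + N - a = d - a + N := by ring
  have e3 : b + N - e + 1 = b - e + 1 + N := by ring
  have key := tendsto_poch_mul_tsum_of_re_pos (a := a) (b := b + N) (d := d + N) (e := e)
    (by rw [add_re, natCast_re]; linarith) (by rwa [e1]) hre2 ha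
    (by rw [e2]; exact add_natCast_ne_neg_natCast hda N)
  rw [e1, e2, e3, add_sub_add_right_eq_sub, Gamma_add_natCast hd, Gamma_add_natCast hbe,
    Gamma_add_natCast hb, Gamma_add_natCast hda] at key
  have hd' := poch_ne_zero hd N
  have hb' := poch_ne_zero hb N
  have hda' := poch_ne_zero hda N
  have hbe' := poch_ne_zero hbe N
  rw [← tendsto_add_atTop_iff_nat N]
  convert key.const_mul (poch b N * poch (d - a) N / (poch d N * poch (b - e + 1) N)) using 2
    with n
  · rw [← mul_assoc, add_comm n N]
    simp only [poch_add _ N n]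
    push_cast
    simp only [← add_assoc]
    congr 1
    field_simp
  · field_simp
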